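/- Let d ≥ 1 and s ≥ 1 be integers and β > 0 a real number. Let b_1, …, b_s ∈ ℝ^d and set Σ_S = Σ_{j=1}^s b_j·b_jᵀ; assume Σ_S is positive definite. Let M ∈ ℝ^{d×d} be a symmetric positive definite matrix such that M − (β/s)·Σ_S is positive semidefinite. Let a, a' ∈ ℝ^d be vectors each of which can be written as a linear combination Σ_{j=1}^s λ_j·b_j with Σ_j λ_j² ≤ 1, and let θ ∈ ℝ^d satisfy |⟨a', θ⟩| ≤ 1. Then |(aᵀ·M⁻¹·a')·⟨a', θ⟩| ≤ s/β. -/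

import Mathlib

open scoped Matrix

/-- Lemma F.4: boundedness of the linear bandit loss estimate. If `M` dominates
`(β/s)·Σ_S` where `Σ_S = Σ_j b_j b_jᵀ` is the spanner second-moment matrix, and
`a, a'` lie in the symmetric convex hull of the spanner (coefficients with
`Σ λ_j² ≤ 1`), then `|(aᵀ M⁻¹ a')·⟨a', θ⟩| ≤ s/β` whenever `|⟨a', θ⟩| ≤ 1`. -/
theorem linear_loss_estimate_bounded
    (d s : ℕ) (hd : 1 ≤ d) (hs : 1 ≤ s) (β : ℝ) (hβ : 0 < β)
    (b : Fin s → Fin d → ℝ)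
    (S : Matrix (Fin d) (Fin d) ℝ)
    (hS : S = ∑ j, Matrix.vecMulVec (b j) (b j))
    (hSpd : S.PosDef)
    (M : Matrix (Fin d) (Fin d) ℝ)
    (hMpd : M.PosDef)
    (hdom : (M - (β / s) • S).PosSemidef)
    (a a' θ : Fin d → ℝ)
    (lam lam' : Fin s → ℝ)
    (ha : a = ∑ j, lam j • b j) (hlam : ∑ j, lam j ^ 2 ≤ 1)
    (ha' : a' = ∑ j, lam' j • b j) (hlam' : ∑ j, lam' j ^ 2 ≤ 1)
    (hθ : |a' ⬝ᵥ θ| ≤ 1) :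
    |(a ⬝ᵥ (M⁻¹ *ᵥ a')) * (a' ⬝ᵥ θ)| ≤ s / β := by
  have hs' : (0 : ℝ) < s := by exact_mod_cast hs
  obtain ⟨c, hc⟩ : ∃ c : ℝ, c = β / s := ⟨_, rfl⟩
  have hc0 : 0 < c := by rw [hc]; positivity
  have hinv : (s : ℝ) / β = 1 / c := by rw [hc, one_div_div]
  rw [← hc] at hdom
  obtain ⟨y, hy⟩ : ∃ y, y = M⁻¹ *ᵥ a' := ⟨_, rfl⟩
  have hMy : M *ᵥ y = a' := by
    rw [hy, Matrix.mulVec_mulVec, Matrix.mul_nonsing_inv _ hMpd.det_pos.ne'.isUnit,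
      Matrix.one_mulVec]
  rw [← hy, hinv]
  obtain ⟨T, hT⟩ : ∃ T : ℝ, T = ∑ j, (b j ⬝ᵥ y) ^ 2 := ⟨_, rfl⟩
  have hT0 : 0 ≤ T := by rw [hT]; positivity
  have key : ∀ l : Fin s → ℝ, ∑ j, l j ^ 2 ≤ 1 → ((∑ j, l j • b j) ⬝ᵥ y) ^ 2 ≤ T := by
    intro l hl
    have h1 : (∑ j, l j • b j) ⬝ᵥ y = ∑ j, l j * (b j ⬝ᵥ y) := by
      simp [sum_dotProduct, smul_dotProduct]
    rw [h1]
    have h2 := Finset.sum_mul_sq_le_sq_mul_sq Finset.univ l (fun j => b j ⬝ᵥ y)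
    rw [← hT] at h2
    nlinarith
  have hp := key lam hlam
  have hq := key lam' hlam'
  rw [← ha] at hp
  rw [← ha'] at hq
  have hSy : y ⬝ᵥ (S *ᵥ y) = T := by
    rw [hS, hT, Matrix.sum_mulVec, dotProduct_sum]
    refine Finset.sum_congr rfl fun j _ => ?_
    rw [Matrix.vecMulVec_mulVec]
    simp [dotProduct_smul, dotProduct_comm y (b j), sq]
  have hdq : c * T ≤ a' ⬝ᵥ y := by
    have h := hdom.dotProduct_mulVec_nonneg y
    rw [Matrix.sub_mulVec, Matrix.smul_mulVec, dotProduct_sub, dotProduct_smul, star_trivial,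
      hMy, hSy, dotProduct_comm, smul_eq_mul] at h
    linarith
  have hTT : c ^ 2 * T ≤ 1 := by
    have h1 : (c * T) ^ 2 ≤ T := le_trans (pow_le_pow_left₀ (by positivity) hdq 2) hq
    rcases hT0.eq_or_lt with h | h
    · rw [← h]; simp
    · by_contra hcon
      push Not at hcon
      nlinarith
  have hpb : |a ⬝ᵥ y| ≤ 1 / c := by
    rw [le_div_iff₀ hc0, ← abs_of_pos hc0, ← abs_mul, ← sq_le_one_iff_abs_le_one]
    rw [mul_pow]
    nlinarith [sq_nonneg c]
  rw [abs_mul]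
  calc |a ⬝ᵥ y| * |a' ⬝ᵥ θ| ≤ |a ⬝ᵥ y| * 1 := by gcongr
    _ ≤ 1 / c := by simpa using hpb
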